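/- Let U = [u_{ij}] ∈ 𝓕 be feasible and suppose there exist real numbers α_j (j = 1,…,n), β_i (i = 1,…,g) and nonnegative reals γ_{ij}, δ_{ij} such that for all i, j: 2 u_{ij} d_{ij}² − α_j − β_i z_j − γ_{ij} + δ_{ij} = 0, γ_{ij} u_{ij} = 0, and δ_{ij}(u_{ij} − 1) = 0. Then U is a global minimizer of J(U) = ∑_{i=1}^{g} ∑_{j=1}^{n} u_{ij}² d_{ij}² over 𝓕. -/

import Mathlib

/-- KKT sufficiency. If a feasible `U` admits multipliers `α, β, γ, δ`
satisfying stationarity, nonnegativity of `γ, δ`, and complementary slackness, then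
`U` is a global minimizer of `J` over the feasible set `𝓕`. -/
theorem kkt_sufficient (g n : ℕ) (z : Fin n → ℝ) (μ : Fin g → ℝ)
    (d : Fin g → Fin n → ℝ) (hd : ∀ i j, 0 ≤ d i j)
    (F : Set (Matrix (Fin g) (Fin n) ℝ))
    (hF : F = {U | (∀ j, ∑ i, U i j = 1) ∧ (∀ i, ∑ j, U i j * z j = μ i) ∧
        (∀ i j, 0 ≤ U i j ∧ U i j ≤ 1)})
    (U : Matrix (Fin g) (Fin n) ℝ) (hU : U ∈ F)
    (α : Fin n → ℝ) (β : Fin g → ℝ) (γ δ : Fin g → Fin n → ℝ)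
    (hγ : ∀ i j, 0 ≤ γ i j) (hδ : ∀ i j, 0 ≤ δ i j)
    (hstat : ∀ i j, 2 * U i j * (d i j) ^ 2 - α j - β i * z j - γ i j + δ i j = 0)
    (hcs₁ : ∀ i j, γ i j * U i j = 0)
    (hcs₂ : ∀ i j, δ i j * (U i j - 1) = 0) :
    ∀ V ∈ F, ∑ i, ∑ j, (U i j) ^ 2 * (d i j) ^ 2 ≤ ∑ i, ∑ j, (V i j) ^ 2 * (d i j) ^ 2 := by
  subst hF
  obtain ⟨hU₁, hU₂, -⟩ := hU
  rintro V ⟨hV₁, hV₂, hV⟩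
  have hpt : ∀ i j, U i j ^ 2 * d i j ^ 2 + (α j * (V i j - U i j) +
      β i * (V i j * z j - U i j * z j)) ≤ V i j ^ 2 * d i j ^ 2 := by
    intro i j
    have hγV := mul_nonneg (hγ i j) (hV i j).1
    have hδV := mul_nonneg (hδ i j) (sub_nonneg.2 (hV i j).2)
    have hsq := mul_nonneg (sq_nonneg (V i j - U i j)) (sq_nonneg (d i j))
    linear_combination hγV + hδV + hsq - (V i j - U i j) * hstat i j + hcs₁ i j - hcs₂ i j
  have hα : ∑ i, ∑ j, α j * (V i j - U i j) = 0 := by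
    rw [Finset.sum_comm]
    simp [← Finset.mul_sum, hU₁, hV₁]
  have hβ : ∑ i, ∑ j, β i * (V i j * z j - U i j * z j) = 0 := by
    simp [← Finset.mul_sum, hU₂, hV₂]
  have hsum := Finset.sum_le_sum fun i (_ : i ∈ Finset.univ) =>
    Finset.sum_le_sum fun j (_ : j ∈ Finset.univ) => hpt i j
  simp only [Finset.sum_add_distrib, hα, hβ, add_zero] at hsum
  exact hsum
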